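/- arXiv:math/0406241 — 2 statements merged into one kernel-verified Lean document; each statement's English description precedes it below -/
import Mathlib

section
/- Let p be an odd prime number and let i be a natural number with 0 ≤ i ≤ e₂(p!), where e₂(p!) denotes the exponent of 2 in the prime factorization of p!. Then S(2^i · p) = p, i.e., p is the smallest positive integer m such that 2^i · p divides m!. -/
open Nat

theorem smarandache_two_pow_mul_prime (p : ℕ) (hp : p.Prime) (hodd : Odd p)
    (i : ℕ) (hi : i ≤ (p !).factorization 2) :
    IsLeast {m : ℕ | 0 < m ∧ 2 ^ i * p ∣ m !} p := by
  refine ⟨⟨hp.pos, ?_⟩, fun m hm => hp.dvd_factorial.mp (dvd_of_mul_left_dvd hm.2)⟩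
  have hcop : Nat.Coprime (2 ^ i) p := (Nat.coprime_two_left.mpr hodd).pow_left i
  have htwo : 2 ^ i ∣ p ! := (pow_dvd_pow 2 hi).trans (Nat.ordProj_dvd (p !) 2)
  exact hcop.mul_dvd_of_dvd_of_dvd htwo (Nat.dvd_factorial hp.pos le_rfl)
end

section
/- Let k be a positive integer such that p = 2^k − 1 is a prime number, and let n = 2^(k−1) · (2^k − 1) be the associated perfect number. Then S(n) = p, i.e., p = 2^k − 1 is the smallest positive integer m such that 2^(k−1) · (2^k − 1) divides m!. -/
open Nat

theorem smarandache_perfect_number (k : ℕ) (hk : 1 ≤ k) (hp : Nat.Prime (2 ^ k - 1)) :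
    IsLeast {m : ℕ | 0 < m ∧ 2 ^ (k - 1) * (2 ^ k - 1) ∣ m !} (2 ^ k - 1) := by
  refine ⟨⟨hp.pos, ?_⟩, fun m hm => hp.dvd_factorial.mp ((Nat.dvd_mul_left _ _).trans hm.2)⟩
  obtain ⟨j, rfl⟩ := Nat.exists_eq_add_of_le' hk
  have hpow : 0 < 2 ^ j := by positivity
  have hodd : Odd (2 ^ (j + 1) - 1) := ⟨2 ^ j - 1, by rw [pow_succ]; omega⟩
  have hle : 2 ^ (j + 1 - 1) ≤ 2 ^ (j + 1) - 1 := by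
    rw [Nat.add_sub_cancel, pow_succ]; omega
  exact (hodd.coprime_two_left.pow_left _).mul_dvd_of_dvd_of_dvd
    (Nat.dvd_factorial (by positivity) hle) (Nat.dvd_factorial hp.pos le_rfl)
end
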